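/- arXiv:2311.14082 — 2 statements merged into one kernel-verified Lean document; each statement's English description precedes it below -/
import Mathlib

section
/- (Slepian's Lemma) Let (X₁, …, Xₙ) and (Y₁, …, Yₙ) be centered (zero-mean) jointly Gaussian random vectors such that E[Xₖ²] = E[Yₖ²] for every k and E[Yₖ Yₗ] ≥ E[Xₖ Xₗ] for every pair k, ℓ. Then for every real T, P(maxₖ Xₖ ≥ T) ≥ P(maxₖ Yₖ ≥ T). -/
open MeasureTheory ProbabilityTheory

/-- A random vector `X : Ω → (Fin n → ℝ)` is centered jointly Gaussian if every
linear functional of it is a centered (possibly degenerate) Gaussian variable. -/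
def IsCenteredGaussianVector {Ω : Type*} [MeasurableSpace Ω] (μ : Measure Ω)
    {n : ℕ} (X : Ω → Fin n → ℝ) : Prop :=
  ∀ c : Fin n → ℝ, ∃ v : NNReal,
    Measure.map (fun ω => ∑ k, c k * X ω k) μ = gaussianReal 0 v

/-- A function vanishing at the origin whose derivative is `O(|t| ^ m)` is `O(|t| ^ (m + 1))`. -/
lemma abs_le_mul_abs_pow_succ_of_hasDerivAt {φ φ' : ℝ → ℝ} {C : ℝ} {m : ℕ}
    (h0 : φ 0 = 0) (hd : ∀ t, HasDerivAt φ (φ' t) t) (hb : ∀ t, |φ' t| ≤ C * |t| ^ m) (x : ℝ) :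
    |φ x| ≤ C * |x| ^ (m + 1) := by
  have hC : 0 ≤ C := by simpa using (abs_nonneg _).trans (hb 1)
  have hseg : ∀ t ∈ segment ℝ 0 x, |t| ≤ |x| := by
    rw [segment_eq_uIcc]
    intro t ht
    simpa using Set.abs_sub_left_of_mem_uIcc ht
  have := (convex_segment (𝕜 := ℝ) 0 x).norm_image_sub_le_of_norm_hasDerivWithin_le
    (f := φ) (f' := φ') (C := C * |x| ^ m) (fun t _ ↦ (hd t).hasDerivWithinAt)
    (fun t ht ↦ (hb t).trans (mul_le_mul_of_nonneg_left
      (pow_le_pow_left₀ (abs_nonneg t) (hseg t ht) m) hC))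
    (left_mem_segment ℝ 0 x) (right_mem_segment ℝ 0 x)
  simpa [h0, pow_succ, mul_assoc] using this

/-- `g` is decreasing with values in `[0, 1]`, and has Taylor expansions of orders up to three
whose coefficients and remainders are controlled by `C` uniformly in the base point. -/
structure IsTestFunction (g : ℝ → ℝ) (C : ℝ) : Prop where
  continuous : Continuous g
  nonneg : ∀ u, 0 ≤ g u
  le_one : ∀ u, g u ≤ 1
  taylor : ∀ u, ∃ a b : ℝ, a ≤ 0 ∧ |a| ≤ C ∧ |b| ≤ C ∧ ∀ t,
    |g (u + t) - g u| ≤ C * |t| ∧ |g (u + t) - g u - a * t| ≤ C * |t| ^ 2 ∧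
      |g (u + t) - g u - a * t - b * t ^ 2| ≤ C * |t| ^ 3

lemma IsTestFunction.nonneg_const {g : ℝ → ℝ} {C : ℝ} (hg : IsTestFunction g C) : 0 ≤ C := by
  obtain ⟨a, -, -, ha, -⟩ := hg.taylor 0
  exact (abs_nonneg a).trans ha

lemma isTestFunction_of_contDiff {g : ℝ → ℝ} {C : ℝ} (hg : ContDiff ℝ 3 g) (hanti : Antitone g)
    (h0 : ∀ u, 0 ≤ g u) (h1 : ∀ u, g u ≤ 1)
    (hb1 : ∀ u, |iteratedDeriv 1 g u| ≤ C) (hb2 : ∀ u, |iteratedDeriv 2 g u| ≤ C)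
    (hb3 : ∀ u, |iteratedDeriv 3 g u| ≤ C) : IsTestFunction g C := by
  have hder (i : ℕ) (hi : i < 3) (u : ℝ) :
      HasDerivAt (iteratedDeriv i g) (iteratedDeriv (i + 1) g u) u := by
    rw [iteratedDeriv_succ]
    exact (hg.differentiable_iteratedDeriv i (by exact_mod_cast hi) u).hasDerivAt
  have hshift (i : ℕ) (hi : i < 3) (u t : ℝ) :
      HasDerivAt (fun t ↦ iteratedDeriv i g (u + t)) (iteratedDeriv (i + 1) g (u + t)) t :=
    (hder i hi (u + t)).comp_const_add u t
  have hC : 0 ≤ C := (abs_nonneg _).trans (hb1 0)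
  refine ⟨hg.continuous, h0, h1, fun u ↦
    ⟨iteratedDeriv 1 g u, iteratedDeriv 2 g u / 2, ?_, hb1 u, ?_, ?_⟩⟩
  · rw [iteratedDeriv_one]
    exact hanti.deriv_nonpos
  · rw [abs_div, abs_two]
    linarith [hb2 u, abs_nonneg (iteratedDeriv 2 g u)]
  · have hlip (i : ℕ) (hi : i < 3) (hb : ∀ v, |iteratedDeriv (i + 1) g v| ≤ C) (t : ℝ) :
        |iteratedDeriv i g (u + t) - iteratedDeriv i g u| ≤ C * |t| ^ 1 :=
      abs_le_mul_abs_pow_succ_of_hasDerivAt (m := 0)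
        (φ := fun t ↦ iteratedDeriv i g (u + t) - iteratedDeriv i g u) (by simp)
        (fun t ↦ (hshift i hi u t).sub_const _) (fun t ↦ by simpa using hb (u + t)) t
    have hquad (i : ℕ) (hi : i < 2) (hb : ∀ v, |iteratedDeriv (i + 2) g v| ≤ C) (t : ℝ) :
        |iteratedDeriv i g (u + t) - iteratedDeriv i g u - iteratedDeriv (i + 1) g u * t|
          ≤ C * |t| ^ 2 :=
      abs_le_mul_abs_pow_succ_of_hasDerivAt
        (φ := fun t ↦ iteratedDeriv i g (u + t) - iteratedDeriv i g u
          - iteratedDeriv (i + 1) g u * t) (by simp)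
        (fun t ↦ by
          simpa using ((hshift i (by omega) u t).sub_const _).fun_sub
            ((hasDerivAt_id t).const_mul (iteratedDeriv (i + 1) g u)))
        (hlip (i + 1) (by omega) hb) t
    intro t
    refine ⟨by simpa using hlip 0 (by omega) hb1 t, by simpa using hquad 0 (by omega) hb2 t, ?_⟩
    refine abs_le_mul_abs_pow_succ_of_hasDerivAt
      (φ := fun t ↦ g (u + t) - g u - iteratedDeriv 1 g u * t - iteratedDeriv 2 g u / 2 * t ^ 2)
      (by simp) (fun t ↦ ?_) (hquad 1 (by omega) hb3) t
    have h := (((hshift 0 (by omega) u t).sub_const (g u)).fun_sub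
      ((hasDerivAt_id t).const_mul (iteratedDeriv 1 g u))).fun_sub
      ((hasDerivAt_pow 2 t).const_mul (iteratedDeriv 2 g u / 2))
    simp only [iteratedDeriv_zero] at h
    refine h.congr_deriv ?_
    norm_num
    ring

lemma exists_abs_iteratedDeriv_smoothTransition_le (i : ℕ) :
    ∃ C, ∀ u, |iteratedDeriv (i + 1) Real.smoothTransition u| ≤ C := by
  have hcont : Continuous (iteratedDeriv (i + 1) Real.smoothTransition) :=
    (Real.smoothTransition.contDiff (n := ⊤)).continuous_iteratedDeriv _ (by exact_mod_cast le_top)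
  obtain ⟨C, hC⟩ := isCompact_Icc.exists_bound_of_continuousOn (s := Set.Icc (0 : ℝ) 1)
    hcont.continuousOn
  refine ⟨max C 0, fun u ↦ ?_⟩
  by_cases hu : u ∈ Set.Icc (0 : ℝ) 1
  · exact (hC u hu).trans (le_max_left _ _)
  · have hconst : ∃ c : ℝ, Real.smoothTransition =ᶠ[nhds u] fun _ ↦ c := by
      rw [Set.mem_Icc, not_and_or, not_le, not_le] at hu
      rcases hu with hu | hu
      · refine ⟨0, ?_⟩
        filter_upwards [Iio_mem_nhds hu] with v hv
        exact Real.smoothTransition.zero_of_nonpos (Set.mem_Iio.1 hv).le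
      · refine ⟨1, ?_⟩
        filter_upwards [Ioi_mem_nhds hu] with v hv
        exact Real.smoothTransition.one_of_one_le (Set.mem_Ioi.1 hv).le
    obtain ⟨c, hc⟩ := hconst
    rw [hc.iteratedDeriv_eq, iteratedDeriv_const]
    simp

lemma exists_isTestFunction_smoothTransition (T m : ℝ) (hm : 0 ≤ m) :
    ∃ C, IsTestFunction (fun u ↦ Real.smoothTransition (m * (T - u))) C := by
  choose B hB using exists_abs_iteratedDeriv_smoothTransition_le
  have hsmooth : ContDiff ℝ 3 Real.smoothTransition := Real.smoothTransition.contDiff (n := 3)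
  have hbound (i : ℕ) (hi : i + 1 ≤ 3) (u : ℝ) :
      |iteratedDeriv (i + 1) (fun u ↦ Real.smoothTransition (m * (T - u))) u|
        ≤ m ^ (i + 1) * B i := by
    have h := iteratedDeriv_comp_const_sub (i + 1) (fun v ↦ Real.smoothTransition (m * v)) T
    rw [congrFun h u, iteratedDeriv_comp_const_mul ((hsmooth.of_le (by exact_mod_cast hi))) m]
    simp only [smul_eq_mul, abs_mul, abs_pow, abs_neg, abs_one, one_pow, one_mul, abs_of_nonneg hm]
    gcongr
    exact hB i _
  refine ⟨max (m ^ 1 * B 0) (max (m ^ 2 * B 1) (m ^ 3 * B 2)), isTestFunction_of_contDiff ?_ ?_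
    (fun u ↦ Real.smoothTransition.nonneg _) (fun u ↦ Real.smoothTransition.le_one _)
    (fun u ↦ (hbound 0 (by omega) u).trans (le_max_left _ _))
    (fun u ↦ (hbound 1 (by omega) u).trans ((le_max_left _ _).trans (le_max_right _ _)))
    (fun u ↦ (hbound 2 (by omega) u).trans ((le_max_right _ _).trans (le_max_right _ _)))⟩
  · exact hsmooth.comp (by fun_prop)
  · intro u v huv
    exact Real.smoothTransition.monotone (by gcongr)

lemma IsTestFunction.exists_prod_taylor {ι : Type*} [Fintype ι] {g : ℝ → ℝ} {C : ℝ}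
    (hg : IsTestFunction g C) (s : Finset ι) :
    ∃ K, 0 ≤ K ∧ ∀ w : ι → ℝ, ∃ (a : ι → ℝ) (H : ι → ι → ℝ),
      (∀ k, a k ≤ 0) ∧ (∀ k l, k ≠ l → 0 ≤ H k l) ∧ ∀ x : ι → ℝ,
        |∏ k ∈ s, g (w k + x k) - ∏ k ∈ s, g (w k)| ≤ K * ‖x‖ ∧
        |∏ k ∈ s, g (w k + x k) - ∏ k ∈ s, g (w k) - ∑ k, a k * x k| ≤ K * ‖x‖ ^ 2 ∧
        |∏ k ∈ s, g (w k + x k) - ∏ k ∈ s, g (w k) - ∑ k, a k * x k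
          - ∑ k, ∑ l, H k l * (x k * x l)| ≤ K * ‖x‖ ^ 3 := by
  classical
  induction s using Finset.induction_on with
  | empty => exact ⟨0, le_rfl, fun w ↦ ⟨0, 0, by simp⟩⟩
  | insert i s hi ih =>
    obtain ⟨K, hK, ih⟩ := ih
    have hC := hg.nonneg_const
    refine ⟨C + 2 * (K * C) + K, by positivity, fun w ↦ ?_⟩
    obtain ⟨a, H, ha, hH, ih⟩ := ih w
    obtain ⟨α, β, hα, hαC, hβC, hexp⟩ := hg.taylor (w i)
    set F₀ := ∏ k ∈ s, g (w k) with hF₀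
    have hF₀_nonneg : 0 ≤ F₀ := Finset.prod_nonneg fun k _ ↦ hg.nonneg _
    set G₀ := g (w i) with hG₀
    have hG₀_nonneg : 0 ≤ G₀ := hg.nonneg _
    have hG₀_le : |G₀| ≤ 1 := by rw [abs_of_nonneg hG₀_nonneg]; exact hg.le_one _
    refine ⟨fun k ↦ G₀ * a k + if k = i then F₀ * α else 0,
      fun k l ↦ G₀ * H k l + (if k = i then α * a l else 0)
        + (if k = i then if l = i then F₀ * β else 0 else 0), fun k ↦ ?_, fun k l hkl ↦ ?_,
      fun x ↦ ?_⟩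
    · dsimp only
      have := mul_nonpos_of_nonneg_of_nonpos hG₀_nonneg (ha k)
      have := mul_nonpos_of_nonneg_of_nonpos hF₀_nonneg hα
      split_ifs <;> linarith
    · dsimp only
      have := mul_nonneg hG₀_nonneg (hH k l hkl)
      have := mul_nonneg_of_nonpos_of_nonpos hα (ha l)
      split_ifs with h1 h2
      · exact absurd (h1.trans h2.symm) hkl
      all_goals linarith
    · obtain ⟨ih1, ih2, ih3⟩ := ih x
      obtain ⟨hG1, hG2, hG3⟩ := hexp (x i)
      have hlin : ∑ k, (G₀ * a k + if k = i then F₀ * α else 0) * x k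
          = G₀ * ∑ k, a k * x k + F₀ * α * x i := by
        simp [add_mul, Finset.sum_add_distrib, Finset.mul_sum, mul_assoc]
      have hquad : ∑ k, ∑ l, (G₀ * H k l + (if k = i then α * a l else 0)
            + (if k = i then if l = i then F₀ * β else 0 else 0)) * (x k * x l)
          = G₀ * ∑ k, ∑ l, H k l * (x k * x l) + α * x i * ∑ l, a l * x l
            + F₀ * β * x i ^ 2 := by
        simp only [add_mul, Finset.sum_add_distrib, Finset.mul_sum, ite_mul, zero_mul]
        congr 1
        · congr 1
          · simp only [mul_assoc]
          · rw [Finset.sum_comm]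
            simp only [Finset.sum_ite_eq', Finset.mem_univ, if_true]
            exact Finset.sum_congr rfl fun l _ ↦ by ring
        · rw [Finset.sum_comm]
          simp only [Finset.sum_ite_eq', Finset.mem_univ, if_true]
          ring
      rw [Finset.prod_insert hi, Finset.prod_insert hi, hlin, hquad]
      set F := ∏ k ∈ s, g (w k + x k) with hF
      set G := g (w i + x i)
      set L := ∑ k, a k * x k
      set Q := ∑ k, ∑ l, H k l * (x k * x l)
      have hF_le : |F| ≤ 1 := by
        rw [hF, abs_of_nonneg (Finset.prod_nonneg fun k _ ↦ hg.nonneg _)]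
        exact Finset.prod_le_one (fun k _ ↦ hg.nonneg _) fun k _ ↦ hg.le_one _
      have hxi : |x i| ≤ ‖x‖ := norm_le_pi_norm x i
      set r := ‖x‖
      have hr : 0 ≤ r := norm_nonneg x
      set t := x i
      replace hG1 : |G - G₀| ≤ C * r := hG1.trans (by gcongr)
      replace hG2 : |G - G₀ - α * t| ≤ C * r ^ 2 := hG2.trans (by gcongr)
      replace hG3 : |G - G₀ - α * t - β * t ^ 2| ≤ C * r ^ 3 := hG3.trans (by gcongr)
      have hαt : |α * t| ≤ C * r := by rw [abs_mul]; gcongr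
      have hβt : |β * t ^ 2| ≤ C * r ^ 2 := by rw [abs_mul, abs_pow]; gcongr
      have hmul {p q A B : ℝ} (hp : |p| ≤ A) (hq : |q| ≤ B) : |p * q| ≤ A * B := by
        rw [abs_mul]
        exact mul_le_mul hp hq (abs_nonneg _) ((abs_nonneg _).trans hp)
      have hKC : 0 ≤ K * C := mul_nonneg hK hC
      refine ⟨?_, ?_, ?_⟩
      · have e : G * F - G₀ * F₀ = F * (G - G₀) + (F - F₀) * G₀ := by ring
        rw [e]
        have := abs_add_le (F * (G - G₀)) ((F - F₀) * G₀)
        have := hmul hF_le hG1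
        have := hmul ih1 hG₀_le
        have := mul_nonneg hKC hr
        linarith
      · have e : G * F - G₀ * F₀ - (G₀ * L + F₀ * α * t)
            = F * (G - G₀ - α * t) + (F - F₀) * (α * t) + (F - F₀ - L) * G₀ := by ring
        rw [e]
        have := abs_add_three (F * (G - G₀ - α * t)) ((F - F₀) * (α * t)) ((F - F₀ - L) * G₀)
        have := hmul hF_le hG2
        have := hmul ih1 hαt
        have := hmul ih2 hG₀_le
        have := mul_nonneg hKC (pow_nonneg hr 2)
        linarith
      · have e : G * F - G₀ * F₀ - (G₀ * L + F₀ * α * t)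
              - (G₀ * Q + α * t * L + F₀ * β * t ^ 2)
            = F * (G - G₀ - α * t - β * t ^ 2) + (F - F₀ - L) * (α * t)
              + (F - F₀) * (β * t ^ 2) + (F - F₀ - L - Q) * G₀ := by ring
        rw [e]
        have := abs_add_le (F * (G - G₀ - α * t - β * t ^ 2) + (F - F₀ - L) * (α * t)
              + (F - F₀) * (β * t ^ 2)) ((F - F₀ - L - Q) * G₀)
        have := abs_add_three (F * (G - G₀ - α * t - β * t ^ 2)) ((F - F₀ - L) * (α * t))
              ((F - F₀) * (β * t ^ 2))
        have := hmul hF_le hG3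
        have := hmul ih2 hαt
        have := hmul ih1 hβt
        have := hmul ih3 hG₀_le
        linarith

/-- Independent multiples `a • X` and `b • X'` of a centered Gaussian sum to `√(a² + b²) • X`. -/
lemma map_smul_conv_map_smul {E : Type*} [NormedAddCommGroup E] [NormedSpace ℝ E]
    [CompleteSpace E] [SecondCountableTopology E] [MeasurableSpace E] [BorelSpace E]
    (P : Measure E) [IsGaussian P] (hP : ∫ x, x ∂P = 0) {a b c : ℝ} (h : a ^ 2 + b ^ 2 = c ^ 2) :
    (P.map (a • ·)).conv (P.map (b • ·)) = P.map (c • ·) := by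
  have hchar (d : ℝ) (L : StrongDual ℝ E) :
      charFunDual (P.map (d • ·)) L = Complex.exp (-(d ^ 2 * Var[L; P] : ℝ) / 2) := by
    have hd : (fun x : E ↦ d • x) = ⇑(d • ContinuousLinearMap.id ℝ E) := by ext; simp
    rw [hd, charFunDual_map, IsGaussian.charFunDual_eq_of_integral_eq_zero hP,
      ContinuousLinearMap.comp_smul, ContinuousLinearMap.comp_id, FunLike.coe_smul,
      variance_smul]
  have (d : ℝ) : IsProbabilityMeasure (P.map (d • · : E → E)) :=
    Measure.isProbabilityMeasure_map (by fun_prop)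
  refine Measure.ext_of_charFunDual (funext fun L ↦ ?_)
  rw [charFunDual_conv, hchar, hchar, hchar, ← Complex.exp_add, ← h]
  congr 1
  push_cast
  ring

lemma integral_conv_of_continuous_of_bounded {E : Type*} [NormedAddCommGroup E]
    [SecondCountableTopology E] [MeasurableSpace E] [BorelSpace E]
    (M P : Measure E) [IsProbabilityMeasure M] [IsProbabilityMeasure P] {f : E → ℝ} {B : ℝ}
    (hf : Continuous f) (hB : ∀ x, ‖f x‖ ≤ B) :
    ∫ z, f z ∂(M.conv P) = ∫ w, ∫ x, f (w + x) ∂P ∂M ∧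
      Integrable (fun w ↦ ∫ x, f (w + x) ∂P) M := by
  refine ⟨integral_conv (.of_bound hf.aestronglyMeasurable B (.of_forall hB)), ?_⟩
  have : Integrable (fun z : E × E ↦ f (z.1 + z.2)) (M.prod P) :=
    .of_bound (by fun_prop) B (.of_forall fun z ↦ hB _)
  exact this.integral_prod_left

/-- If replacing `P` by `Q` at scale `c` costs at most `D * c ^ 3` at every base point, then
`∫ f ∂P ≤ ∫ f ∂Q`: this is Lindeberg's replacement argument for centered Gaussian measures. -/
lemma integral_le_integral_of_forall_smul_le {E : Type*} [NormedAddCommGroup E] [NormedSpace ℝ E]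
    [CompleteSpace E] [SecondCountableTopology E] [MeasurableSpace E] [BorelSpace E]
    (P Q : Measure E) [IsGaussian P] [IsGaussian Q] (hP : ∫ x, x ∂P = 0) (hQ : ∫ x, x ∂Q = 0)
    {f : E → ℝ} {B D : ℝ} (hf : Continuous f) (hB : ∀ x, ‖f x‖ ≤ B)
    (hstep : ∀ w, ∀ c : ℝ, 0 ≤ c →
      ∫ x, f (w + c • x) ∂P ≤ ∫ x, f (w + c • x) ∂Q + D * c ^ 3) :
    ∫ x, f x ∂P ≤ ∫ x, f x ∂Q := by
  have hPr (d : ℝ) : IsProbabilityMeasure (P.map (d • · : E → E)) :=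
    Measure.isProbabilityMeasure_map (by fun_prop)
  have hQr (d : ℝ) : IsProbabilityMeasure (Q.map (d • · : E → E)) :=
    Measure.isProbabilityMeasure_map (by fun_prop)
  have hbound (N : ℕ) :
      ∫ x, f x ∂P ≤ ∫ x, f x ∂Q + (N + 1 : ℕ) * (D * √(1 / (N + 1 : ℕ)) ^ 3) := by
    set h : ℝ := 1 / (N + 1 : ℕ) with hh
    have hh0 : 0 ≤ h := by positivity
    have hNh : (N + 1 : ℕ) * h = 1 := by rw [hh]; field_simp
    let M (i : ℕ) : Measure E :=
      (P.map (√((N + 1 : ℕ) * h - i * h) • ·)).conv (Q.map (√(i * h) • ·))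
    have hM (i : ℕ) (hi : i < N + 1) :
        ∫ x, f x ∂(M i) ≤ ∫ x, f x ∂(M (i + 1)) + D * √h ^ 3 := by
      have hi' : ((i + 1 : ℕ) : ℝ) * h ≤ (N + 1 : ℕ) * h := by gcongr; omega
      let W : Measure E :=
        (P.map (√((N + 1 : ℕ) * h - (i + 1 : ℕ) * h) • ·)).conv (Q.map (√(i * h) • ·))
      have hMi : M i = W.conv (P.map (√h • ·)) := by
        rw [Measure.conv_assoc, Measure.conv_comm (Q.map _), ← Measure.conv_assoc,
          map_smul_conv_map_smul P hP (c := √((N + 1 : ℕ) * h - i * h))]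
        rw [Real.sq_sqrt (by linarith), Real.sq_sqrt hh0, Real.sq_sqrt] <;>
          push_cast at hi' ⊢ <;> linarith
      have hMi' : M (i + 1) = W.conv (Q.map (√h • ·)) := by
        rw [Measure.conv_assoc, map_smul_conv_map_smul Q hQ (c := √((i + 1 : ℕ) * h))]
        rw [Real.sq_sqrt (by positivity), Real.sq_sqrt hh0, Real.sq_sqrt (by positivity)]
        push_cast
        ring
      obtain ⟨hP1, hP2⟩ := integral_conv_of_continuous_of_bounded W (P.map (√h • ·)) hf hB
      obtain ⟨hQ1, hQ2⟩ := integral_conv_of_continuous_of_bounded W (Q.map (√h • ·)) hf hB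
      have hmap (w : E) (ν : Measure E) :
          ∫ x, f (w + x) ∂(ν.map (√h • ·)) = ∫ x, f (w + √h • x) ∂ν :=
        integral_map (by fun_prop) (by fun_prop)
      rw [hMi, hMi', hP1, hQ1]
      calc ∫ w, ∫ x, f (w + x) ∂(P.map (√h • ·)) ∂W
          ≤ ∫ w, (∫ x, f (w + x) ∂(Q.map (√h • ·)) + D * √h ^ 3) ∂W := by
            refine integral_mono hP2 (hQ2.add (integrable_const _)) fun w ↦ ?_
            simp only [hmap]
            exact hstep w _ (Real.sqrt_nonneg h)
        _ = ∫ w, ∫ x, f (w + x) ∂(Q.map (√h • ·)) ∂W + D * √h ^ 3 := by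
            rw [integral_add hQ2 (integrable_const _)]
            simp
    have htel (i : ℕ) (hi : i ≤ N + 1) :
        ∫ x, f x ∂(M 0) ≤ ∫ x, f x ∂(M i) + i * (D * √h ^ 3) := by
      induction i with
      | zero => simp
      | succ i ih =>
        have := ih (by omega)
        have := hM i (by omega)
        push_cast
        linarith
    have hzero (ν : Measure E) [IsProbabilityMeasure ν] :
        ν.map (fun x ↦ (0 : ℝ) • x) = Measure.dirac 0 := by
      simp [Measure.map_const]
    have hM0 : M 0 = P := by
      simp only [M, hNh, Nat.cast_zero, zero_mul, sub_zero, Real.sqrt_zero, Real.sqrt_one, hzero]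
      simp
    have hMN : M (N + 1) = Q := by
      simp only [M, hNh, sub_self, Real.sqrt_zero, Real.sqrt_one, hzero]
      simp
    simpa only [hM0, hMN] using htel (N + 1) le_rfl
  refine ge_of_tendsto' (f := fun N : ℕ ↦
    ∫ x, f x ∂Q + (N + 1 : ℕ) * (D * √(1 / (N + 1 : ℕ)) ^ 3)) (x := Filter.atTop) ?_ hbound
  have hlim : Filter.Tendsto (fun N : ℕ ↦ √(1 / ((N : ℝ) + 1))) Filter.atTop (nhds 0) := by
    simpa using (tendsto_one_div_add_atTop_nhds_zero_nat (𝕜 := ℝ)).sqrt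
  have hrw (N : ℕ) : ((N + 1 : ℕ) : ℝ) * (D * √(1 / (N + 1 : ℕ)) ^ 3) = D * √(1 / ((N : ℝ) + 1)) := by
    have h1 : √(1 / ((N : ℝ) + 1)) ^ 2 = 1 / ((N : ℝ) + 1) := Real.sq_sqrt (by positivity)
    push_cast
    rw [pow_succ, h1]
    field_simp
  simp_rw [hrw]
  simpa using (hlim.const_mul D).const_add (∫ x, f x ∂Q)

/-- A second-order upper bound for `f` at `w` integrates to an upper bound at scale `c`. -/
lemma integral_sub_taylor_le {ι : Type*} [Fintype ι] (P : Measure (ι → ℝ)) [IsGaussian P]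
    (hP : ∀ k, ∫ x, x k ∂P = 0) {f : (ι → ℝ) → ℝ} {B K : ℝ} (hf : Continuous f)
    (hB : ∀ x, ‖f x‖ ≤ B) (w : ι → ℝ) (a : ι → ℝ) (H : ι → ι → ℝ)
    (htaylor : ∀ x : ι → ℝ, |f (w + x) - f w - ∑ k, a k * x k
          - ∑ k, ∑ l, H k l * (x k * x l)| ≤ K * ‖x‖ ^ 3) (c : ℝ) (hc : 0 ≤ c) :
    |∫ x, f (w + c • x) ∂P - (f w + c ^ 2 * ∑ k, ∑ l, H k l * ∫ x, x k * x l ∂P)|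
      ≤ K * (∫ x, ‖x‖ ^ 3 ∂P) * c ^ 3 := by
  have hmem (p : ENNReal) (hp : p ≠ ⊤) (k : ι) : MemLp (fun x : ι → ℝ ↦ x k) p P :=
    IsGaussian.memLp_dual P (ContinuousLinearMap.proj k) p hp
  have h1 (k : ι) : Integrable (fun x : ι → ℝ ↦ x k) P :=
    (hmem 1 (by simp) k).integrable le_rfl
  have h2 (k l : ι) : Integrable (fun x : ι → ℝ ↦ x k * x l) P :=
    (hmem 2 (by simp) k).integrable_mul (hmem 2 (by simp) l)
  have h3 : Integrable (fun x : ι → ℝ ↦ ‖x‖ ^ 3) P := by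
    simpa using (IsGaussian.memLp_id P 3 (by simp)).integrable_norm_pow (by simp)
  have hfi : Integrable (fun x ↦ f (w + c • x)) P :=
    .of_bound (by fun_prop) B (.of_forall fun x ↦ hB _)
  have hL : Integrable (fun x : ι → ℝ ↦ ∑ k, a k * (c * x k)) P :=
    integrable_finsetSum _ fun k _ ↦ ((h1 k).const_mul c).const_mul _
  have hQ : Integrable (fun x : ι → ℝ ↦ ∑ k, ∑ l, H k l * (c * x k * (c * x l))) P := by
    refine integrable_finsetSum _ fun k _ ↦ integrable_finsetSum _ fun l _ ↦ ?_
    have : (fun x : ι → ℝ ↦ H k l * (c * x k * (c * x l)))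
        = fun x ↦ H k l * c ^ 2 * (x k * x l) := by ext; ring
    rw [this]
    exact (h2 k l).const_mul _
  have hLi : ∫ x, ∑ k, a k * (c * x k) ∂P = 0 := by
    rw [integral_finsetSum _ fun k _ ↦ ((h1 k).const_mul c).const_mul _]
    simp [integral_const_mul, hP]
  have hQi : ∫ x, ∑ k, ∑ l, H k l * (c * x k * (c * x l)) ∂P
      = c ^ 2 * ∑ k, ∑ l, H k l * ∫ x, x k * x l ∂P := by
    have : (fun x : ι → ℝ ↦ ∑ k, ∑ l, H k l * (c * x k * (c * x l)))
        = fun x ↦ c ^ 2 * ∑ k, ∑ l, H k l * (x k * x l) := by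
      ext x
      simp only [Finset.mul_sum]
      exact Finset.sum_congr rfl fun k _ ↦ Finset.sum_congr rfl fun l _ ↦ by ring
    rw [this, integral_const_mul, integral_finsetSum _ fun k _ ↦
      integrable_finsetSum _ fun l _ ↦ (h2 k l).const_mul _]
    congr 1
    refine Finset.sum_congr rfl fun k _ ↦ ?_
    rw [integral_finsetSum _ fun l _ ↦ (h2 k l).const_mul _]
    simp only [integral_const_mul]
  have hsplit : ∫ x, f (w + c • x) ∂P - (f w + c ^ 2 * ∑ k, ∑ l, H k l * ∫ x, x k * x l ∂P)
      = ∫ x, (f (w + c • x) - f w - ∑ k, a k * (c * x k)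
          - ∑ k, ∑ l, H k l * (c * x k * (c * x l))) ∂P := by
    have hf0 : Integrable (fun x ↦ f (w + c • x) - f w) P := hfi.sub (integrable_const _)
    have hf1 : Integrable (fun x ↦ f (w + c • x) - f w - ∑ k, a k * (c * x k)) P := hf0.sub hL
    rw [integral_sub hf1 hQ, integral_sub hf0 hL, integral_sub hfi (integrable_const _), hLi, hQi,
      integral_const, probReal_univ, one_smul]
    ring
  rw [hsplit]
  calc |∫ x, (f (w + c • x) - f w - ∑ k, a k * (c * x k)
          - ∑ k, ∑ l, H k l * (c * x k * (c * x l))) ∂P|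
      ≤ ∫ x, K * c ^ 3 * ‖x‖ ^ 3 ∂P := by
        rw [← Real.norm_eq_abs]
        refine norm_integral_le_of_norm_le (h3.const_mul _) (.of_forall fun x ↦ ?_)
        have := htaylor (c • x)
        simp only [Pi.smul_apply, smul_eq_mul, norm_smul, Real.norm_eq_abs, abs_of_nonneg hc] at this
        rw [Real.norm_eq_abs]
        exact this.trans_eq (by ring)
    _ = K * (∫ x, ‖x‖ ^ 3 ∂P) * c ^ 3 := by
        rw [integral_const_mul]
        ring

/-- The expectation of a product of decreasing test functions increases with the off-diagonal
covariances of a centered Gaussian measure. -/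
lemma IsTestFunction.integral_prod_le_integral_prod {ι : Type*} [Fintype ι] {g : ℝ → ℝ} {C : ℝ}
    (hg : IsTestFunction g C) (P Q : Measure (ι → ℝ)) [IsGaussian P] [IsGaussian Q]
    (hP : ∀ k, ∫ x, x k ∂P = 0) (hQ : ∀ k, ∫ x, x k ∂Q = 0)
    (hvar : ∀ k, ∫ x, x k * x k ∂P = ∫ x, x k * x k ∂Q)
    (hcov : ∀ k l, ∫ x, x k * x l ∂P ≤ ∫ x, x k * x l ∂Q) :
    ∫ x, ∏ k, g (x k) ∂P ≤ ∫ x, ∏ k, g (x k) ∂Q := by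
  have hcont : Continuous fun x : ι → ℝ ↦ ∏ k, g (x k) :=
    continuous_finsetProd _ fun k _ ↦ hg.continuous.comp (continuous_apply k)
  have hbound (x : ι → ℝ) : ‖∏ k, g (x k)‖ ≤ 1 := by
    rw [Real.norm_of_nonneg (Finset.prod_nonneg fun k _ ↦ hg.nonneg _)]
    exact Finset.prod_le_one (fun k _ ↦ hg.nonneg _) fun k _ ↦ hg.le_one _
  have hmean (ν : Measure (ι → ℝ)) [IsGaussian ν] (hν : ∀ k, ∫ x, x k ∂ν = 0) :
      ∫ x, x ∂ν = 0 := by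
    ext k
    have hint (i : ι) : Integrable (fun x : ι → ℝ ↦ x i) ν :=
      IsGaussian.integrable_dual ν (ContinuousLinearMap.proj i)
    exact (eval_integral (f := fun x : ι → ℝ ↦ x) hint k).trans (hν k)
  obtain ⟨K, -, hK⟩ := hg.exists_prod_taylor (Finset.univ : Finset ι)
  refine integral_le_integral_of_forall_smul_le P Q (hmean P hP) (hmean Q hQ)
    (D := K * ∫ x, ‖x‖ ^ 3 ∂P + K * ∫ x, ‖x‖ ^ 3 ∂Q) hcont hbound fun w c hc ↦ ?_
  obtain ⟨a, H, -, hH, htaylor⟩ := hK w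
  have h1 := abs_le.1 (integral_sub_taylor_le P hP hcont hbound w a H
    (fun x ↦ (htaylor x).2.2) c hc)
  have h2 := abs_le.1 (integral_sub_taylor_le Q hQ hcont hbound w a H
    (fun x ↦ (htaylor x).2.2) c hc)
  have hquad : ∑ k, ∑ l, H k l * ∫ x, x k * x l ∂P ≤ ∑ k, ∑ l, H k l * ∫ x, x k * x l ∂Q := by
    refine Finset.sum_le_sum fun k _ ↦ Finset.sum_le_sum fun l _ ↦ ?_
    rcases eq_or_ne k l with rfl | hkl
    · rw [hvar]
    · exact mul_le_mul_of_nonneg_left (hcov k l) (hH k l hkl)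
  have := mul_le_mul_of_nonneg_left hquad (sq_nonneg c)
  linarith [h1.2, h2.1]

/-- **Slepian's inequality** for centered Gaussian measures, in terms of orthants. -/
lemma measure_forall_lt_le_of_isGaussian {ι : Type*} [Fintype ι]
    (P Q : Measure (ι → ℝ)) [IsGaussian P] [IsGaussian Q]
    (hP : ∀ k, ∫ x, x k ∂P = 0) (hQ : ∀ k, ∫ x, x k ∂Q = 0)
    (hvar : ∀ k, ∫ x, x k * x k ∂P = ∫ x, x k * x k ∂Q)
    (hcov : ∀ k l, ∫ x, x k * x l ∂P ≤ ∫ x, x k * x l ∂Q) (T : ℝ) :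
    P {x | ∀ k, x k < T} ≤ Q {x | ∀ k, x k < T} := by
  have hmeas : MeasurableSet {x : ι → ℝ | ∀ k, x k < T} := by measurability
  let f (m : ℕ) (x : ι → ℝ) : ℝ := ∏ k, Real.smoothTransition (m * (T - x k))
  have hlim (x : ι → ℝ) : Filter.Tendsto (fun m ↦ f m x) Filter.atTop
      (nhds ({x : ι → ℝ | ∀ k, x k < T}.indicator 1 x)) := by
    by_cases hx : ∀ k, x k < T
    · rw [Set.indicator_of_mem (by exact hx)]
      have hev (k : ι) : ∀ᶠ m : ℕ in Filter.atTop, Real.smoothTransition (m * (T - x k)) = 1 := by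
        filter_upwards [(tendsto_natCast_atTop_atTop.atTop_mul_const
          (sub_pos.2 (hx k))).eventually_ge_atTop 1] with m hm
        exact Real.smoothTransition.one_of_one_le hm
      refine tendsto_const_nhds.congr' ?_
      filter_upwards [Filter.eventually_all.2 hev] with m hm
      simp [f, hm]
    · rw [Set.indicator_of_notMem (by exact hx)]
      push Not at hx
      obtain ⟨k, hk⟩ := hx
      refine tendsto_const_nhds.congr fun m ↦ (Finset.prod_eq_zero (Finset.mem_univ k) ?_).symm
      exact Real.smoothTransition.zero_of_nonpos
        (mul_nonpos_of_nonneg_of_nonpos m.cast_nonneg (by linarith))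
  have hint (ν : Measure (ι → ℝ)) [IsProbabilityMeasure ν] :
      Filter.Tendsto (fun m ↦ ∫ x, f m x ∂ν) Filter.atTop
        (nhds (ν.real {x | ∀ k, x k < T})) := by
    rw [← integral_indicator_one hmeas]
    refine tendsto_integral_of_dominated_convergence (fun _ ↦ 1) (fun m ↦ ?_)
      (integrable_const _) (fun m ↦ .of_forall fun x ↦ ?_) (.of_forall hlim)
    · exact (continuous_finsetProd _ fun k _ ↦ Real.smoothTransition.continuous.comp
        (by fun_prop)).aestronglyMeasurable
    · rw [Real.norm_of_nonneg (Finset.prod_nonneg fun k _ ↦ Real.smoothTransition.nonneg _)]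
      exact Finset.prod_le_one (fun k _ ↦ Real.smoothTransition.nonneg _)
        fun k _ ↦ Real.smoothTransition.le_one _
  rw [← ENNReal.toReal_le_toReal (measure_ne_top _ _) (measure_ne_top _ _)]
  refine le_of_tendsto_of_tendsto' (hint P) (hint Q) fun m ↦ ?_
  obtain ⟨C, hC⟩ := exists_isTestFunction_smoothTransition T m m.cast_nonneg
  exact hC.integral_prod_le_integral_prod P Q hP hQ hvar hcov

lemma IsCenteredGaussianVector.isGaussian_map {Ω : Type*} [MeasurableSpace Ω] {μ : Measure Ω}
    {n : ℕ} {X : Ω → Fin n → ℝ} (hX : IsCenteredGaussianVector μ X) (hmeas : Measurable X) :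
    IsGaussian (μ.map X) := by
  refine isGaussian_of_map_eq_gaussianReal fun L ↦ ?_
  obtain ⟨v, hv⟩ := hX fun k ↦ L (Pi.single k 1)
  refine ⟨0, v, ?_⟩
  rw [Measure.map_map (by fun_prop) hmeas, ← hv]
  congr 1
  ext ω
  have : L (X ω) = ∑ k, L (Pi.single k (X ω k)) := by
    rw [← map_sum, Finset.univ_sum_single]
  rw [Function.comp_apply, this]
  refine Finset.sum_congr rfl fun k _ ↦ ?_
  rw [mul_comm, ← smul_eq_mul, ← map_smul, ← Pi.single_smul, smul_eq_mul, mul_one]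

lemma IsCenteredGaussianVector.integral_eval_map {Ω : Type*} [MeasurableSpace Ω] {μ : Measure Ω}
    {n : ℕ} {X : Ω → Fin n → ℝ} (hX : IsCenteredGaussianVector μ X) (hmeas : Measurable X)
    (k : Fin n) : ∫ x, x k ∂(μ.map X) = 0 := by
  obtain ⟨v, hv⟩ := hX (Pi.single k 1)
  have hk : (fun ω ↦ ∑ j, (Pi.single k 1 : Fin n → ℝ) j * X ω j) = fun ω ↦ X ω k := by
    ext ω
    simp [Pi.single_apply]
  rw [hk] at hv
  rw [integral_map hmeas.aemeasurable (measurable_pi_apply k).aestronglyMeasurable]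
  have := integral_map (μ := μ) (φ := fun ω ↦ X ω k) (f := fun y : ℝ ↦ y) (by fun_prop)
    (by fun_prop)
  rw [← this, hv, integral_id_gaussianReal]

/-- **Slepian's Lemma.** If `X`, `Y` are centered jointly Gaussian vectors with
`E[Xₖ²] = E[Yₖ²]` for every `k` and `E[Yₖ Yₗ] ≥ E[Xₖ Xₗ]` for all `k, ℓ`, then for
every `T`, `P(max X ≥ T) ≥ P(max Y ≥ T)`. -/
theorem slepian_lemma
    {Ω : Type*} [MeasurableSpace Ω] (μ : Measure Ω) [IsProbabilityMeasure μ]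
    {n : ℕ} (hn : 0 < n) (X Y : Ω → Fin n → ℝ)
    (hXmeas : Measurable X) (hYmeas : Measurable Y)
    (hX : IsCenteredGaussianVector μ X) (hY : IsCenteredGaussianVector μ Y)
    (hvar : ∀ k, ∫ ω, X ω k * X ω k ∂μ = ∫ ω, Y ω k * Y ω k ∂μ)
    (hcov : ∀ k ℓ, ∫ ω, X ω k * X ω ℓ ∂μ ≤ ∫ ω, Y ω k * Y ω ℓ ∂μ) :
    ∀ T : ℝ, μ {ω | T ≤ ⨆ k, Y ω k} ≤ μ {ω | T ≤ ⨆ k, X ω k} := by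
  intro T
  have := hX.isGaussian_map hXmeas
  have := hY.isGaussian_map hYmeas
  have hmoment {Z : Ω → Fin n → ℝ} (hZ : Measurable Z) (k l : Fin n) :
      ∫ x, x k * x l ∂(μ.map Z) = ∫ ω, Z ω k * Z ω l ∂μ :=
    integral_map hZ.aemeasurable (by fun_prop)
  have hmeas : MeasurableSet {x : Fin n → ℝ | ∀ k, x k < T} := by measurability
  have key := measure_forall_lt_le_of_isGaussian (μ.map X) (μ.map Y)
    (hX.integral_eval_map hXmeas) (hY.integral_eval_map hYmeas)
    (fun k ↦ by rw [hmoment hXmeas, hmoment hYmeas, hvar])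
    (fun k l ↦ by rw [hmoment hXmeas, hmoment hYmeas]; exact hcov k l) T
  rw [Measure.map_apply hXmeas hmeas, Measure.map_apply hYmeas hmeas] at key
  have : Nonempty (Fin n) := ⟨⟨0, hn⟩⟩
  have hcompl (Z : Ω → Fin n → ℝ) :
      {ω | T ≤ ⨆ k, Z ω k} = (Z ⁻¹' {x | ∀ k, x k < T})ᶜ := by
    ext ω
    simp only [Set.mem_ofPred_eq, Set.mem_compl_iff, Set.mem_preimage, not_forall, not_lt]
    refine ⟨fun h ↦ ?_, fun ⟨k, hk⟩ ↦ hk.trans (le_ciSup (Set.finite_range _).bddAbove k)⟩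
    obtain ⟨k, hk⟩ := exists_eq_ciSup_of_finite (f := fun k ↦ Z ω k)
    exact ⟨k, hk ▸ h⟩
  rw [hcompl, hcompl, prob_compl_eq_one_sub (hYmeas hmeas), prob_compl_eq_one_sub (hXmeas hmeas)]
  exact tsub_le_tsub_left key 1
end

section
/- Let (X₁, …, Xₙ) be a centered jointly Gaussian random vector with E[Xₖ²] = 1 for all k and E[Xₖ Xₗ] ≤ ρ for all k ≠ ℓ, where 0 ≤ ρ ≤ 1, and let (Y₁, …, Yₙ) be a centered jointly Gaussian vector with E[Yₖ²] = 1 for all k and E[Yₖ Yₗ] = ρ for all k ≠ ℓ. Then for every real T, P(maxₖ Xₖ ≥ T) ≥ P(maxₖ Yₖ ≥ T). -/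
open MeasureTheory ProbabilityTheory

open Filter Topology

/-- A nonincreasing function with values in `[0, 1]`, with a first order Taylor expansion that is
uniform with constant `K`; `f'` plays the role of the derivative of `f`. -/
structure IsSmoothCutoff (f f' : ℝ → ℝ) (K : ℝ) : Prop where
  continuous : Continuous f
  nonneg : ∀ x, 0 ≤ f x
  le_one : ∀ x, f x ≤ 1
  deriv_nonpos : ∀ x, f' x ≤ 0
  abs_deriv_le : ∀ x, |f' x| ≤ K
  abs_sub_le : ∀ x u, |f (x + u) - f x| ≤ K * |u|
  abs_taylor_le : ∀ x u, |f (x + u) - f x - f' x * u| ≤ K * u ^ 2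

namespace IsSmoothCutoff

variable {f f' : ℝ → ℝ} {K : ℝ}

lemma K_nonneg (hf : IsSmoothCutoff f f' K) : 0 ≤ K :=
  (abs_nonneg _).trans (hf.abs_deriv_le 0)

lemma abs_sub_le_one (hf : IsSmoothCutoff f f' K) (x y : ℝ) : |f x - f y| ≤ 1 := by
  rw [abs_le]
  constructor <;> linarith [hf.nonneg x, hf.nonneg y, hf.le_one x, hf.le_one y]

lemma of_hasDerivAt {f'' : ℝ → ℝ} (hd : ∀ x, HasDerivAt f (f' x) x)
    (hd' : ∀ x, HasDerivAt f' (f'' x) x) (h0 : ∀ x, 0 ≤ f x) (h1 : ∀ x, f x ≤ 1)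
    (hneg : ∀ x, f' x ≤ 0) (hK : ∀ x, |f' x| ≤ K) (hK' : ∀ x, |f'' x| ≤ K) :
    IsSmoothCutoff f f' K where
  continuous := continuous_iff_continuousAt.2 fun x => (hd x).continuousAt
  nonneg := h0
  le_one := h1
  deriv_nonpos := hneg
  abs_deriv_le := hK
  abs_sub_le x u := by
    have := convex_univ.norm_image_sub_le_of_norm_hasDerivWithin_le (𝕜 := ℝ) (f := f) (f' := f')
      (fun y _ => (hd y).hasDerivWithinAt) (fun y _ => hK y) (Set.mem_univ x)
      (Set.mem_univ (x + u))
    simpa using this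
  abs_taylor_le x u := by
    have hK0 : 0 ≤ K := (abs_nonneg _).trans (hK 0)
    have hlip (y z : ℝ) : |f' z - f' y| ≤ K * |z - y| :=
      convex_univ.norm_image_sub_le_of_norm_hasDerivWithin_le (𝕜 := ℝ) (f := f') (f' := f'')
        (fun y _ => (hd' y).hasDerivWithinAt) (fun y _ => hK' y) (Set.mem_univ y)
        (Set.mem_univ z)
    have hg (t : ℝ) : HasDerivAt (fun t => f t - f' x * t) (f' t - f' x) t := by
      simpa using (hd t).fun_sub ((hasDerivAt_id' t).const_mul (f' x))
    have hb : ∀ t ∈ Set.uIcc x (x + u), ‖f' t - f' x‖ ≤ K * |u| := fun t ht => by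
      refine (hlip x t).trans (mul_le_mul_of_nonneg_left ?_ hK0)
      simpa using Set.abs_sub_left_of_mem_uIcc ht
    have := (convex_uIcc x (x + u)).norm_image_sub_le_of_norm_hasDerivWithin_le (𝕜 := ℝ)
      (fun t _ => (hg t).hasDerivWithinAt) hb Set.left_mem_uIcc Set.right_mem_uIcc
    have e : f (x + u) - f' x * (x + u) - (f x - f' x * x) = f (x + u) - f x - f' x * u := by ring
    rw [e, Real.norm_eq_abs, Real.norm_eq_abs, add_sub_cancel_left, mul_assoc, abs_mul_abs_self,
      ← sq] at this
    exact this

lemma abs_mul_sub_le (hf : IsSmoothCutoff f f' K) {x y u v r : ℝ} (hu : |u| ≤ r) (hv : |v| ≤ r) :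
    |(f (x + u) - f x) * (f (y + v) - f y) - f' x * f' y * (u * v)| ≤ 2 * K ^ 2 * r ^ 3 := by
  have hK := hf.K_nonneg
  have hr : 0 ≤ r := (abs_nonneg _).trans hu
  have e : (f (x + u) - f x) * (f (y + v) - f y) - f' x * f' y * (u * v) =
      (f (x + u) - f x) * (f (y + v) - f y - f' y * v) +
        (f (x + u) - f x - f' x * u) * (f' y * v) := by ring
  have h1 : |f (x + u) - f x| ≤ K * r :=
    (hf.abs_sub_le x u).trans (mul_le_mul_of_nonneg_left hu hK)
  have h2 : |f (y + v) - f y - f' y * v| ≤ K * r ^ 2 := by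
    refine (hf.abs_taylor_le y v).trans (mul_le_mul_of_nonneg_left ?_ hK)
    rw [← sq_abs]; gcongr
  have h3 : |f (x + u) - f x - f' x * u| ≤ K * r ^ 2 := by
    refine (hf.abs_taylor_le x u).trans (mul_le_mul_of_nonneg_left ?_ hK)
    rw [← sq_abs]; gcongr
  have h4 : |f' y * v| ≤ K * r := by
    rw [abs_mul]; exact mul_le_mul (hf.abs_deriv_le y) hv (abs_nonneg _) hK
  rw [e]
  refine (abs_add_le _ _).trans ?_
  rw [abs_mul, abs_mul]
  calc _ ≤ (K * r) * (K * r ^ 2) + (K * r ^ 2) * (K * r) := by gcongr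
    _ = _ := by ring

end IsSmoothCutoff

section Comparison

variable {ι : Type*} [Fintype ι]

lemma ProbabilityTheory.IsGaussian.integrable_norm_pow_three (m : Measure (ι → ℝ)) [IsGaussian m] :
    Integrable (fun w => ‖w‖ ^ 3) m := by
  simpa using (IsGaussian.memLp_id m 3 (by simp)).integrable_norm_pow (by norm_num)

lemma ProbabilityTheory.IsGaussian.integrable_eval_mul_eval (m : Measure (ι → ℝ)) [IsGaussian m]
    (k l : ι) : Integrable (fun w => w k * w l) m := by
  have h (k : ι) : MemLp (fun w : ι → ℝ => w k) 2 m :=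
    IsGaussian.memLp_dual m (ContinuousLinearMap.proj k) 2 (by simp)
  exact (h k).integrable_mul (h l)

/-- The first order marginals of `m` and `m'` agree, and the covariances of `m` are dominated by
those of `m'`. -/
structure CovLE (m m' : Measure (ι → ℝ)) : Prop where
  map_eval : ∀ k, m.map (fun w => w k) = m'.map (fun w => w k)
  cov_le : ∀ k l, k ≠ l → ∫ w, w k * w l ∂m ≤ ∫ w, w k * w l ∂m'

variable {f f' : ℝ → ℝ} {K : ℝ}

/-- Third order approximation of a single term in the expansion of `∏ k, f (z k + h * w k)`, by a
function whose integral is monotone in the covariances. -/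
lemma IsSmoothCutoff.exists_approx [DecidableEq ι] (hf : IsSmoothCutoff f f' K)
    {m m' : Measure (ι → ℝ)}
    [IsGaussian m] [IsGaussian m'] (hm : CovLE m m') (z : ι → ℝ) {h : ℝ} (hh : 0 ≤ h)
    (S : Finset ι) :
    ∃ Q : (ι → ℝ) → ℝ, Integrable Q m ∧ Integrable Q m' ∧ ∫ w, Q w ∂m ≤ ∫ w, Q w ∂m' ∧
      ∀ w, |(∏ k ∈ S, (f (z k + h * w k) - f (z k))) * ∏ k ∈ Sᶜ, f (z k) - Q w| ≤
        (2 * K ^ 2 + K ^ 3) * (h * ‖w‖) ^ 3 := by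
  have hK := hf.K_nonneg
  have hB (w : ι → ℝ) : 0 ≤ (2 * K ^ 2 + K ^ 3) * (h * ‖w‖) ^ 3 := by positivity
  have hP0 : 0 ≤ ∏ k ∈ Sᶜ, f (z k) := Finset.prod_nonneg fun k _ => hf.nonneg _
  have hP1 : ∏ k ∈ Sᶜ, f (z k) ≤ 1 :=
    Finset.prod_le_one (fun k _ => hf.nonneg _) fun k _ => hf.le_one _
  have habs (w : ι → ℝ) (k : ι) : |h * w k| ≤ h * ‖w‖ := by
    rw [abs_mul, abs_of_nonneg hh]
    exact mul_le_mul_of_nonneg_left (norm_le_pi_norm w k) hh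
  have hfc := hf.continuous
  rcases Nat.lt_or_ge 2 S.card with h3 | h2
  · refine ⟨0, integrable_zero _ _ _, integrable_zero _ _ _, by simp, fun w => ?_⟩
    set r := min 1 (K * (h * ‖w‖)) with hr
    have hr0 : 0 ≤ r := le_min zero_le_one (by positivity)
    have hS : |∏ k ∈ S, (f (z k + h * w k) - f (z k))| ≤ (K * (h * ‖w‖)) ^ 3 := by
      rw [Finset.abs_prod]
      calc _ ≤ ∏ _k ∈ S, r := Finset.prod_le_prod (fun _ _ => abs_nonneg _) fun k _ =>
            le_min (hf.abs_sub_le_one _ _) ((hf.abs_sub_le _ _).trans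
              (mul_le_mul_of_nonneg_left (habs w k) hK))
        _ = r ^ S.card := by simp
        _ ≤ r ^ 3 := pow_le_pow_of_le_one hr0 (min_le_left _ _) h3
        _ ≤ _ := pow_le_pow_left₀ hr0 (min_le_right _ _) 3
    rw [Pi.zero_apply, sub_zero, abs_mul, abs_of_nonneg hP0]
    calc _ ≤ (K * (h * ‖w‖)) ^ 3 * 1 := by gcongr
      _ = K ^ 3 * (h * ‖w‖) ^ 3 := by ring
      _ ≤ _ := by gcongr; nlinarith [sq_nonneg K]
  rcases Nat.lt_or_ge S.card 2 with h1 | h2'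
  · set T : (ι → ℝ) → ℝ := fun w =>
      (∏ k ∈ S, (f (z k + h * w k) - f (z k))) * ∏ k ∈ Sᶜ, f (z k) with hT
    have hTc : Continuous T := by fun_prop
    have hTb (w : ι → ℝ) : ‖T w‖ ≤ 1 := by
      rw [hT, Real.norm_eq_abs, abs_mul, abs_of_nonneg hP0, Finset.abs_prod]
      exact mul_le_one₀ (Finset.prod_le_one (fun _ _ => abs_nonneg _)
        fun k _ => hf.abs_sub_le_one _ _) hP0 hP1
    refine ⟨T, .of_bound hTc.aestronglyMeasurable 1 (.of_forall hTb),
      .of_bound hTc.aestronglyMeasurable 1 (.of_forall hTb), le_of_eq ?_, fun w => ?_⟩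
    · rcases Nat.lt_or_ge S.card 1 with h0 | h0
      · obtain rfl : S = ∅ := by simpa using h0
        simp [hT]
      · obtain ⟨k, rfl⟩ := Finset.card_eq_one.1 (show S.card = 1 by omega)
        simp only [hT, Finset.prod_singleton]
        rw [integral_mul_const, integral_mul_const]
        have key (μ : Measure (ι → ℝ)) : ∫ w, (f (z k + h * w k) - f (z k)) ∂μ =
            ∫ x, (f (z k + h * x) - f (z k)) ∂(μ.map (fun w => w k)) := by
          rw [integral_map (measurable_pi_apply k).aemeasurable]
          exact Continuous.aestronglyMeasurable (by fun_prop)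
        rw [key, key, hm.map_eval]
    · simpa [hT] using hB w
  · obtain ⟨k, l, hkl, rfl⟩ := Finset.card_eq_two.1 (le_antisymm h2 h2')
    set P := ∏ k ∈ ({k, l} : Finset ι)ᶜ, f (z k)
    have hi (μ : Measure (ι → ℝ)) [IsGaussian μ] := IsGaussian.integrable_eval_mul_eval μ k l
    refine ⟨fun w => (f' (z k) * f' (z l) * h ^ 2 * P) * (w k * w l), (hi m).const_mul _,
      (hi m').const_mul _, ?_, fun w => ?_⟩
    · rw [integral_const_mul, integral_const_mul]
      have := mul_nonneg_of_nonpos_of_nonpos (hf.deriv_nonpos (z k)) (hf.deriv_nonpos (z l))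
      exact mul_le_mul_of_nonneg_left (hm.cov_le k l hkl) (by positivity)
    · rw [Finset.prod_pair hkl]
      have e : (f (z k + h * w k) - f (z k)) * (f (z l + h * w l) - f (z l)) * P -
          f' (z k) * f' (z l) * h ^ 2 * P * (w k * w l) =
          ((f (z k + h * w k) - f (z k)) * (f (z l + h * w l) - f (z l)) -
            f' (z k) * f' (z l) * ((h * w k) * (h * w l))) * P := by ring
      rw [e, abs_mul, abs_of_nonneg hP0]
      calc _ ≤ 2 * K ^ 2 * (h * ‖w‖) ^ 3 * 1 :=
            mul_le_mul (hf.abs_mul_sub_le (habs w k) (habs w l)) hP1 hP0 (by positivity)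
        _ ≤ _ := by rw [mul_one]; gcongr; nlinarith [pow_nonneg hK 3]

lemma IsSmoothCutoff.norm_prod_le_one (hf : IsSmoothCutoff f f' K) (x : ι → ℝ) :
    ‖∏ k, f (x k)‖ ≤ 1 := by
  rw [Real.norm_of_nonneg (Finset.prod_nonneg fun k _ => hf.nonneg _)]
  exact Finset.prod_le_one (fun k _ => hf.nonneg _) fun k _ => hf.le_one _

/-- Replacing a small increment with law `m` by one with law `m'` changes the expectation of
`∏ k, f (z k)` in the favourable direction, up to a third order error. -/
lemma IsSmoothCutoff.exists_integral_sub_le (hf : IsSmoothCutoff f f' K) {m m' : Measure (ι → ℝ)}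
    [IsGaussian m] [IsGaussian m'] (hm : CovLE m m') :
    ∃ C : ℝ, ∀ (z : ι → ℝ) (h : ℝ), 0 ≤ h →
      ∫ w, ∏ k, f (z k + h * w k) ∂m ≤ ∫ w, ∏ k, f (z k + h * w k) ∂m' + C * h ^ 3 := by
  classical
  have hfc := hf.continuous
  set B := 2 * K ^ 2 + K ^ 3
  set M := ∫ w, ‖w‖ ^ 3 ∂m
  set M' := ∫ w, ‖w‖ ^ 3 ∂m'
  refine ⟨∑ _S : Finset ι, B * (M + M'), fun z h hh => ?_⟩
  set T : Finset ι → (ι → ℝ) → ℝ := fun S w =>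
      (∏ k ∈ S, (f (z k + h * w k) - f (z k))) * ∏ k ∈ Sᶜ, f (z k) with hT
  have hsum (w : ι → ℝ) : ∏ k, f (z k + h * w k) = ∑ S, T S w := by
    rw [hT, ← Fintype.prod_add]; simp
  have hTi (S : Finset ι) (μ : Measure (ι → ℝ)) [IsGaussian μ] : Integrable (T S) μ := by
    refine .of_bound (C := 1) (Continuous.aestronglyMeasurable (by fun_prop)) (.of_forall fun w => ?_)
    rw [hT, Real.norm_eq_abs, abs_mul, Finset.abs_prod, Finset.abs_prod]
    refine mul_le_one₀ (Finset.prod_le_one (fun _ _ => abs_nonneg _)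
        fun k _ => hf.abs_sub_le_one _ _) (Finset.prod_nonneg fun _ _ => abs_nonneg _)
        (Finset.prod_le_one (fun _ _ => abs_nonneg _) fun k _ => ?_)
    rw [abs_of_nonneg (hf.nonneg _)]
    exact hf.le_one _
  have key (S : Finset ι) : ∫ w, T S w ∂m ≤ ∫ w, T S w ∂m' + B * (M + M') * h ^ 3 := by
    obtain ⟨Q, hQ, hQ', hle, hb⟩ := hf.exists_approx hm z hh S
    have n (μ : Measure (ι → ℝ)) [IsGaussian μ] := IsGaussian.integrable_norm_pow_three μ
    have i1 : ∫ w, T S w ∂m ≤ ∫ w, (Q w + B * h ^ 3 * ‖w‖ ^ 3) ∂m := by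
      refine integral_mono (hTi S m) (hQ.add ((n m).const_mul _)) fun w => ?_
      have := (abs_le.1 (hb w)).2
      rw [mul_pow, ← mul_assoc] at this
      simp only [hT]; linarith
    have i2 : ∫ w, (Q w - B * h ^ 3 * ‖w‖ ^ 3) ∂m' ≤ ∫ w, T S w ∂m' := by
      refine integral_mono (hQ'.sub ((n m').const_mul _)) (hTi S m') fun w => ?_
      have := (abs_le.1 (hb w)).1
      rw [mul_pow, ← mul_assoc] at this
      simp only [hT]; linarith
    rw [integral_add hQ ((n m).const_mul _), integral_const_mul] at i1
    rw [integral_sub hQ' ((n m').const_mul _), integral_const_mul] at i2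
    linarith
  simp_rw [hsum]
  rw [integral_finsetSum _ fun S _ => hTi S m, integral_finsetSum _ fun S _ => hTi S m',
    Finset.sum_mul, ← Finset.sum_add_distrib]
  exact Finset.sum_le_sum fun S _ => key S

/-- Stability of centered Gaussian measures. -/
lemma ProbabilityTheory.IsGaussian.map_smul_add_smul (m : Measure (ι → ℝ)) [IsGaussian m]
    (h0 : ∀ L : StrongDual ℝ (ι → ℝ), m[L] = 0) (a b : ℝ) :
    (m.prod m).map (fun p => a • p.1 + b • p.2) = m.map (fun x => √(a ^ 2 + b ^ 2) • x) := by
  set c : ℂ := ⟨a, b⟩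
  have hr : ‖c‖ = √(a ^ 2 + b ^ 2) := by
    rw [Complex.norm_def, Complex.normSq_apply]; simp [c, sq]
  have ha : a = √(a ^ 2 + b ^ 2) * Real.cos c.arg := by
    rw [← hr, Complex.norm_mul_cos_arg]
  have hb : b = √(a ^ 2 + b ^ 2) * Real.sin c.arg := by
    rw [← hr, Complex.norm_mul_sin_arg]
  have hrot := IsGaussian.map_rotation_eq_self_of_forall_strongDual_eq_zero h0 c.arg
  set r := √(a ^ 2 + b ^ 2)
  have hfst : (m.prod m).map Prod.fst = m := by simp
  conv_rhs => rw [← hfst, ← hrot]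
  rw [Measure.map_map (by fun_prop) (by fun_prop), Measure.map_map (by fun_prop) (by fun_prop)]
  congr 1
  ext p k
  simp only [Function.comp_apply, ContinuousLinearMap.rotation_apply, Pi.add_apply, Pi.smul_apply,
    smul_eq_mul]
  nth_rewrite 1 [ha]
  nth_rewrite 1 [hb]
  ring

lemma ProbabilityTheory.IsGaussian.integral_integral_smul_add_smul (m : Measure (ι → ℝ))
    [IsGaussian m] (h0 : ∀ L : StrongDual ℝ (ι → ℝ), m[L] = 0) (a b : ℝ) {G : (ι → ℝ) → ℝ}
    (hG : Continuous G) {B : ℝ} (hB : ∀ x, ‖G x‖ ≤ B) :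
    ∫ x, G (√(a ^ 2 + b ^ 2) • x) ∂m = ∫ x, ∫ x', G (a • x + b • x') ∂m ∂m := by
  rw [← integral_map (f := G) (φ := fun x => √(a ^ 2 + b ^ 2) • x) (by fun_prop)
      hG.aestronglyMeasurable, ← IsGaussian.map_smul_add_smul m h0,
    integral_map (by fun_prop) hG.aestronglyMeasurable,
    integral_prod _ (.of_bound (C := B) (Continuous.aestronglyMeasurable (by fun_prop))
      (.of_forall fun p => hB _))]

lemma IsSmoothCutoff.exists_integral_prod_le (hf : IsSmoothCutoff f f' K)
    {m m' : Measure (ι → ℝ)} [IsGaussian m] [IsGaussian m']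
    (h0 : ∀ L : StrongDual ℝ (ι → ℝ), m[L] = 0) (h0' : ∀ L : StrongDual ℝ (ι → ℝ), m'[L] = 0)
    (hm : CovLE m m') :
    ∃ C : ℝ, ∀ a b h : ℝ, 0 ≤ h →
      ∫ p, ∏ k, f (√(a ^ 2 + h ^ 2) * p.1 k + b * p.2 k) ∂(m.prod m') ≤
        ∫ p, ∏ k, f (a * p.1 k + √(b ^ 2 + h ^ 2) * p.2 k) ∂(m.prod m') + C * h ^ 3 := by
  have hfc := hf.continuous
  obtain ⟨C, hC⟩ := hf.exists_integral_sub_le hm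
  refine ⟨C, fun a b h hh => ?_⟩
  have hi {α : Type _} [MeasurableSpace α] [TopologicalSpace α] [OpensMeasurableSpace α]
      [SecondCountableTopology α]
      (μ : Measure α) [IsFiniteMeasure μ] (u : α → ι → ℝ)
      (hu : Continuous u) : Integrable (fun x => ∏ k, f (u x k)) μ :=
    .of_bound (C := 1) (Continuous.aestronglyMeasurable (by fun_prop))
      (.of_forall fun p => hf.norm_prod_le_one _)
  have e1 (y : ι → ℝ) : ∫ x, ∏ k, f (√(a ^ 2 + h ^ 2) * x k + b * y k) ∂m =
      ∫ x, ∫ x', ∏ k, f ((a * x k + b * y k) + h * x' k) ∂m ∂m := by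
    have := IsGaussian.integral_integral_smul_add_smul m h0 a h
      (G := fun v => ∏ k, f (v k + b * y k)) (by fun_prop) (B := 1)
      (fun x => hf.norm_prod_le_one fun k => x k + b * y k)
    simpa [add_right_comm] using this
  have e2 (x : ι → ℝ) : ∫ y, ∏ k, f (a * x k + √(b ^ 2 + h ^ 2) * y k) ∂m' =
      ∫ y, ∫ y', ∏ k, f ((a * x k + b * y k) + h * y' k) ∂m' ∂m' := by
    have := IsGaussian.integral_integral_smul_add_smul m' h0' b h
      (G := fun v => ∏ k, f (a * x k + v k)) (by fun_prop) (B := 1)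
      (fun y => hf.norm_prod_le_one fun k => a * x k + y k)
    simpa [add_assoc] using this
  have j (μ : Measure (ι → ℝ)) [IsGaussian μ] : Integrable (fun p : (ι → ℝ) × (ι → ℝ) =>
      ∫ w, ∏ k, f ((a * p.1 k + b * p.2 k) + h * w k) ∂μ) (m.prod m') :=
    (hi ((m.prod m').prod μ) (fun q k => (a * q.1.1 k + b * q.1.2 k) + h * q.2 k)
      (by fun_prop)).integral_prod_left
  rw [integral_prod_symm _ (hi _ (fun (p : (ι → ℝ) × (ι → ℝ)) k => √(a ^ 2 + h ^ 2) * p.1 k + b * p.2 k) (by fun_prop)),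
    integral_prod _ (hi _ (fun (p : (ι → ℝ) × (ι → ℝ)) k => a * p.1 k + √(b ^ 2 + h ^ 2) * p.2 k) (by fun_prop))]
  simp_rw [e1, e2]
  rw [← integral_prod_symm _ (j m), ← integral_prod _ (j m')]
  calc _ ≤ ∫ p, (∫ w, ∏ k, f ((a * p.1 k + b * p.2 k) + h * w k) ∂m' + C * h ^ 3) ∂(m.prod m') :=
        integral_mono (j m) ((j m').add (integrable_const _)) fun p =>
          hC (fun k => a * p.1 k + b * p.2 k) h hh
    _ = _ := by rw [integral_add (j m') (integrable_const _)]; simp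

/-- Comparison of expectations of products of smooth cutoffs. -/
lemma IsSmoothCutoff.integral_prod_le (hf : IsSmoothCutoff f f' K)
    {m m' : Measure (ι → ℝ)} [IsGaussian m] [IsGaussian m']
    (h0 : ∀ L : StrongDual ℝ (ι → ℝ), m[L] = 0) (h0' : ∀ L : StrongDual ℝ (ι → ℝ), m'[L] = 0)
    (hm : CovLE m m') :
    ∫ x, ∏ k, f (x k) ∂m ≤ ∫ x, ∏ k, f (x k) ∂m' := by
  have hfc := hf.continuous
  obtain ⟨C, hC⟩ := hf.exists_integral_prod_le h0 h0' hm
  have hfin (n : ℕ) : ∫ x, ∏ k, f (x k) ∂m ≤ ∫ x, ∏ k, f (x k) ∂m' +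
      C * √((n : ℝ) + 1)⁻¹ := by
    set N : ℝ := (n : ℝ) + 1
    have hN : 0 < N := by positivity
    set J : ℕ → ℝ := fun i =>
      ∫ p, ∏ k, f (√(i / N) * p.1 k + √((N - i) / N) * p.2 k) ∂(m.prod m') with hJ
    have step (i : ℕ) (hi : i ≤ n) : J (i + 1) ≤ J i + C * √N⁻¹ ^ 3 := by
      have hi' : (i : ℝ) ≤ n := by exact_mod_cast hi
      have := hC √(i / N) √((N - (i + 1)) / N) √N⁻¹ (Real.sqrt_nonneg _)
      have hpos : 0 ≤ (N - (i + 1)) / N := div_nonneg (by simp only [N]; linarith) hN.le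
      rw [Real.sq_sqrt (by positivity), Real.sq_sqrt (by positivity), Real.sq_sqrt hpos,
        show (i : ℝ) / N + N⁻¹ = (i + 1) / N by ring,
        show (N - (i + 1)) / N + N⁻¹ = (N - i) / N by ring] at this
      simpa only [hJ, Nat.cast_add, Nat.cast_one] using this
    have ind (i : ℕ) (hi : i ≤ n + 1) : J i ≤ J 0 + i * (C * √N⁻¹ ^ 3) := by
      induction i with
      | zero => simp
      | succ i ih =>
        have h1 := ih (by omega)
        have h2 := step i (by omega)
        push_cast
        linarith
    have h1 := ind (n + 1) le_rfl
    have hcast : ((n + 1 : ℕ) : ℝ) = N := by simp [N]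
    have eN : J (n + 1) = ∫ x, ∏ k, f (x k) ∂m := by
      simp only [hJ, hcast, div_self hN.ne', sub_self, zero_div, Real.sqrt_one, Real.sqrt_zero,
        one_mul, zero_mul, add_zero]
      rw [integral_fun_fst (μ := m) (ν := m') (fun x => ∏ k, f (x k))]
      simp
    have e0 : J 0 = ∫ x, ∏ k, f (x k) ∂m' := by
      simp only [hJ, Nat.cast_zero, sub_zero, div_self hN.ne', zero_div, Real.sqrt_one,
        Real.sqrt_zero, one_mul, zero_mul, zero_add]
      rw [integral_fun_snd (μ := m) (ν := m') (fun x => ∏ k, f (x k))]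
      simp
    have e3 : N * (C * √N⁻¹ ^ 3) = C * √N⁻¹ := by
      rw [pow_succ, Real.sq_sqrt (by positivity)]
      field_simp
    rwa [eN, e0, hcast, e3] at h1
  have hlim : Tendsto (fun n : ℕ => ∫ x, ∏ k, f (x k) ∂m' + C * √((n : ℝ) + 1)⁻¹) atTop
      (𝓝 (∫ x, ∏ k, f (x k) ∂m' + C * √0)) := by
    refine tendsto_const_nhds.add (Tendsto.const_mul _ (Tendsto.sqrt ?_))
    simpa using tendsto_one_div_add_atTop_nhds_zero_nat (𝕜 := ℝ)
  simpa using ge_of_tendsto' hlim hfin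

lemma isSmoothCutoff_sigmoid (T : ℝ) {a : ℝ} (ha : 0 ≤ a) (b : ℝ) :
    IsSmoothCutoff (fun x => Real.sigmoid (a * (T - x) - b))
      (fun x => -a * (Real.sigmoid (a * (T - x) - b) * (1 - Real.sigmoid (a * (T - x) - b))))
      (a + a ^ 2) := by
  set s : ℝ → ℝ := fun x => Real.sigmoid (a * (T - x) - b) with hs
  have hs0 (x : ℝ) : 0 ≤ s x := Real.sigmoid_nonneg _
  have hs1 (x : ℝ) : s x ≤ 1 := Real.sigmoid_le_one _
  have hd (x : ℝ) : HasDerivAt s (-a * (s x * (1 - s x))) x := by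
    have h : HasDerivAt (fun x => a * (T - x) - b) (-a) x := by
      simpa using (((hasDerivAt_id' x).const_sub T).const_mul a).sub_const b
    have e : -a * (s x * (1 - s x)) = s x * (1 - s x) * -a := by ring
    rw [e]
    exact HasDerivAt.comp (h₂ := Real.sigmoid) x (Real.hasDerivAt_sigmoid _) h
  have hd' (x : ℝ) : HasDerivAt (fun x => -a * (s x * (1 - s x)))
      (a ^ 2 * (s x * (1 - s x) * (1 - 2 * s x))) x := by
    have e : a ^ 2 * (s x * (1 - s x) * (1 - 2 * s x)) =
        -a * (-a * (s x * (1 - s x)) * (1 - s x) + s x * -(-a * (s x * (1 - s x)))) := by ring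
    rw [e]
    exact ((hd x).fun_mul ((hd x).const_sub 1)).const_mul (-a)
  have hp (x : ℝ) : 0 ≤ s x * (1 - s x) := mul_nonneg (hs0 x) (by linarith [hs1 x])
  have hp1 (x : ℝ) : s x * (1 - s x) ≤ 1 := mul_le_one₀ (hs1 x) (by linarith [hs1 x])
    (by linarith [hs0 x])
  refine .of_hasDerivAt hd hd' hs0 hs1 (fun x => ?_) (fun x => ?_) fun x => ?_
  · nlinarith [hp x]
  · rw [abs_mul, abs_neg, abs_of_nonneg ha, abs_of_nonneg (hp x)]
    nlinarith [hp1 x]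
  · have h2 : |1 - 2 * s x| ≤ 1 := by
      rw [abs_le]; constructor <;> linarith [hs0 x, hs1 x]
    rw [abs_mul, abs_mul, abs_of_nonneg (sq_nonneg a), abs_of_nonneg (hp x)]
    have : s x * (1 - s x) * |1 - 2 * s x| ≤ 1 := mul_le_one₀ (hp1 x) (abs_nonneg _) h2
    nlinarith [sq_nonneg a]

lemma tendsto_sigmoid_indicator (T x : ℝ) :
    Tendsto (fun n : ℕ => Real.sigmoid ((n : ℝ) ^ 2 * (T - x) - n)) atTop
      (𝓝 (if x < T then 1 else 0)) := by
  have hn : Tendsto (fun n : ℕ => (n : ℝ)) atTop atTop := tendsto_natCast_atTop_atTop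
  split_ifs with h
  · refine Real.tendsto_sigmoid_atTop.comp ?_
    have h1 : Tendsto (fun n : ℕ => (n : ℝ) * (T - x) - 1) atTop atTop :=
      tendsto_atTop_add_const_right _ _ (hn.atTop_mul_const (sub_pos.2 h))
    refine (hn.atTop_mul_atTop₀ h1).congr fun n => by ring
  · refine Real.tendsto_sigmoid_atBot.comp ?_
    refine tendsto_atBot_mono (fun n => ?_) (tendsto_neg_atTop_atBot.comp hn)
    have : (n : ℝ) ^ 2 * (T - x) ≤ 0 :=
      mul_nonpos_of_nonneg_of_nonpos (by positivity) (by linarith)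
    simp only [Function.comp_apply]
    linarith

lemma measurableSet_forall_lt (T : ℝ) : MeasurableSet {x : ι → ℝ | ∀ k, x k < T} := by
  rw [Set.ofPred_forall]
  exact .iInter fun k => measurableSet_lt (measurable_pi_apply k) measurable_const

lemma tendsto_integral_prod_sigmoid (m : Measure (ι → ℝ)) [IsProbabilityMeasure m] (T : ℝ) :
    Tendsto (fun n : ℕ => ∫ x, ∏ k, Real.sigmoid ((n : ℝ) ^ 2 * (T - x k) - n) ∂m) atTop
      (𝓝 (m.real {x | ∀ k, x k < T})) := by
  have he : m.real {x | ∀ k, x k < T} = ∫ x, ∏ k, (if x k < T then (1 : ℝ) else 0) ∂m := by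
    rw [← integral_indicator_one (measurableSet_forall_lt T)]
    congr 1
    ext x
    rw [Finset.prod_ite_zero]
    simp [Set.indicator_apply]
  rw [he]
  refine tendsto_integral_of_dominated_convergence (fun _ => 1)
    (fun n => Continuous.aestronglyMeasurable (by have := continuous_sigmoid; fun_prop))
    (integrable_const _) (fun n => .of_forall fun x => ?_) (.of_forall fun x => ?_)
  · exact (isSmoothCutoff_sigmoid T (sq_nonneg (n : ℝ)) n).norm_prod_le_one x
  · exact tendsto_finsetProd _ fun k _ => tendsto_sigmoid_indicator T (x k)

/-- **Slepian's inequality**, for Gaussian measures. -/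
lemma measure_forall_lt_le_of_covLE {m m' : Measure (ι → ℝ)} [IsGaussian m] [IsGaussian m']
    (h0 : ∀ L : StrongDual ℝ (ι → ℝ), m[L] = 0) (h0' : ∀ L : StrongDual ℝ (ι → ℝ), m'[L] = 0)
    (hm : CovLE m m') (T : ℝ) : m {x | ∀ k, x k < T} ≤ m' {x | ∀ k, x k < T} := by
  have h := le_of_tendsto_of_tendsto' (tendsto_integral_prod_sigmoid m T)
    (tendsto_integral_prod_sigmoid m' T)
    fun n => (isSmoothCutoff_sigmoid T (sq_nonneg (n : ℝ)) n).integral_prod_le h0 h0' hm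
  exact (ENNReal.toReal_le_toReal (measure_ne_top _ _) (measure_ne_top _ _)).1 h

end Comparison

namespace IsCenteredGaussianVector

variable {Ω : Type*} [MeasurableSpace Ω] {μ : Measure Ω} {n : ℕ} {X : Ω → Fin n → ℝ}

lemma exists_map_map_eq (hX : IsCenteredGaussianVector μ X) (hmeas : Measurable X)
    (L : StrongDual ℝ (Fin n → ℝ)) : ∃ v : NNReal, (μ.map X).map L = gaussianReal 0 v := by
  obtain ⟨v, hv⟩ := hX fun k => L (Pi.single k 1)
  refine ⟨v, ?_⟩
  rw [Measure.map_map (by fun_prop) hmeas, ← hv]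
  congr 1
  ext ω
  simp only [Function.comp_apply]
  conv_lhs => rw [pi_eq_sum_univ' (X ω)]
  simp [map_sum, mul_comm, Pi.single]

lemma isGaussian_map_s2 (hX : IsCenteredGaussianVector μ X) (hmeas : Measurable X) :
    IsGaussian (μ.map X) :=
  isGaussian_of_map_eq_gaussianReal fun L => ⟨0, hX.exists_map_map_eq hmeas L⟩

lemma integral_strongDual (hX : IsCenteredGaussianVector μ X) (hmeas : Measurable X)
    (L : StrongDual ℝ (Fin n → ℝ)) : (μ.map X)[L] = 0 := by
  obtain ⟨v, hv⟩ := hX.exists_map_map_eq hmeas L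
  rw [← integral_map (f := fun x => x) (φ := L) (by fun_prop) (by fun_prop), hv,
    integral_id_gaussianReal]

lemma map_eval (hX : IsCenteredGaussianVector μ X) (hmeas : Measurable X) {k : Fin n}
    (hvar : ∫ ω, X ω k * X ω k ∂μ = 1) :
    (μ.map X).map (fun w => w k) = gaussianReal 0 1 := by
  obtain ⟨v, hv⟩ := hX.exists_map_map_eq hmeas (ContinuousLinearMap.proj k)
  have hv' : (μ.map X).map (fun w => w k) = gaussianReal 0 v := hv
  have h1 : ∫ x, x * x ∂(gaussianReal 0 v) = 1 := by
    rw [← hv', integral_map (measurable_pi_apply k).aemeasurable (by fun_prop),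
      integral_map hmeas.aemeasurable (Measurable.aestronglyMeasurable (by fun_prop)), hvar]
  have h2 := variance_fun_id_gaussianReal (μ := 0) (v := v)
  rw [variance_of_integral_eq_zero (by fun_prop) integral_id_gaussianReal] at h2
  simp_rw [sq] at h2
  rw [h1] at h2
  rw [hv', show v = 1 from NNReal.eq (by simpa using h2.symm)]

end IsCenteredGaussianVector

/-- If `X` is a centered Gaussian vector with unit variances and pairwise
covariances at most `ρ`, and `Y` is the equicorrelated centered Gaussian vector
with correlation `ρ`, then `P(max X ≥ T) ≥ P(max Y ≥ T)` for every `T`. -/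
theorem exceedance_ge_of_equicorrelated
    {Ω : Type*} [MeasurableSpace Ω] (μ : Measure Ω) [IsProbabilityMeasure μ]
    {n : ℕ} (hn : 0 < n) (ρ : ℝ) (hρ0 : 0 ≤ ρ) (hρ1 : ρ ≤ 1)
    (X Y : Ω → Fin n → ℝ) (hXmeas : Measurable X) (hYmeas : Measurable Y)
    (hX : IsCenteredGaussianVector μ X) (hY : IsCenteredGaussianVector μ Y)
    (hXvar : ∀ k, ∫ ω, X ω k * X ω k ∂μ = 1)
    (hXcov : ∀ k ℓ, k ≠ ℓ → ∫ ω, X ω k * X ω ℓ ∂μ ≤ ρ)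
    (hYvar : ∀ k, ∫ ω, Y ω k * Y ω k ∂μ = 1)
    (hYcov : ∀ k ℓ, k ≠ ℓ → ∫ ω, Y ω k * Y ω ℓ ∂μ = ρ) :
    ∀ T : ℝ, μ {ω | T ≤ ⨆ k, Y ω k} ≤ μ {ω | T ≤ ⨆ k, X ω k} := by
  intro T
  have hmX := hX.isGaussian_map_s2 hXmeas
  have hmY := hY.isGaussian_map_s2 hYmeas
  have hcov (Z : Ω → Fin n → ℝ) (hZ : Measurable Z) (k l : Fin n) :
      ∫ w, w k * w l ∂(μ.map Z) = ∫ ω, Z ω k * Z ω l ∂μ :=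
    integral_map hZ.aemeasurable (Measurable.aestronglyMeasurable (by fun_prop))
  have hle : CovLE (μ.map X) (μ.map Y) :=
    { map_eval := fun k => by
        rw [hX.map_eval hXmeas (hXvar k), hY.map_eval hYmeas (hYvar k)]
      cov_le := fun k l hkl => by
        rw [hcov X hXmeas, hcov Y hYmeas, hYcov k l hkl]
        exact hXcov k l hkl }
  have key := measure_forall_lt_le_of_covLE (hX.integral_strongDual hXmeas)
    (hY.integral_strongDual hYmeas) hle T
  have hms := measurableSet_forall_lt (ι := Fin n) T
  rw [Measure.map_apply hXmeas hms, Measure.map_apply hYmeas hms] at key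
  have : Nonempty (Fin n) := ⟨⟨0, hn⟩⟩
  have hset (Z : Ω → Fin n → ℝ) :
      {ω | T ≤ ⨆ k, Z ω k} = (Z ⁻¹' {x : Fin n → ℝ | ∀ k, x k < T})ᶜ := by
    ext ω
    have hlt : (⨆ k, Z ω k) < T ↔ ∀ k, Z ω k < T := by
      constructor
      · exact fun h k => (le_ciSup (Set.finite_range _).bddAbove k).trans_lt h
      · intro h
        obtain ⟨k, hk⟩ := exists_eq_ciSup_of_finite (f := Z ω)
        exact hk ▸ h k
    simp only [Set.mem_ofPred_eq, Set.mem_compl_iff, Set.mem_preimage]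
    rw [← hlt, not_lt]
  rw [hset, hset, prob_compl_eq_one_sub (hXmeas hms), prob_compl_eq_one_sub (hYmeas hms)]
  exact tsub_le_tsub_left key 1
end
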